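/- Finite-time extinction of the cascaded β-subsystem of the control target system: let L > 0, μ₁, μ₂ > 0, let θ : [0,L] → ℝ be continuous, and let β_s, β_f be C¹ on [0,L] × [0,∞) satisfying ∂_t β_s(x,t) − μ₁ ∂_x β_s(x,t) = 0, ∂_t β_f(x,t) − μ₂ ∂_x β_f(x,t) = θ(x)·β_s(0,t) for all x ∈ [0,L], t ≥ 0, with boundary conditions β_s(L,t) = 0 and β_f(L,t) = 0 for all t ≥ 0. Then β_s(x,t) = 0 for all t ≥ (L − x)/μ₁, and β_f(x,t) = 0 for all t ≥ L/μ₁ + (L − x)/μ₂. -/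

import Mathlib

open Set Function in
/-- A solution of the homogeneous transport equation `∂ₜβ = μ ∂ₓβ` on `(0, L) × (T, ∞)` which
vanishes on the inflow boundary `x = L` from time `T` on vanishes at `x` from time
`T + (L - x) / μ` on. -/
theorem transport_eq_zero_of_inflow_eq_zero {L μ T : ℝ} (hμ : 0 < μ) (hT : 0 ≤ T)
    {β : ℝ → ℝ → ℝ} (hβ : DifferentiableOn ℝ (uncurry β) (Icc 0 L ×ˢ Ici 0))
    (hpde : ∀ x ∈ Ioo 0 L, ∀ t ∈ Ioi T,
      deriv (fun s => β x s) t - μ * deriv (fun y => β y t) x = 0)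
    (hbc : ∀ t ∈ Ici T, β L t = 0) {x : ℝ} (hx : x ∈ Icc 0 L) {t : ℝ}
    (ht : T + (L - x) / μ ≤ t) : β x t = 0 := by
  rcases hx.2.eq_or_lt with rfl | hxL
  · exact hbc t (by simpa using ht)
  set S := (L - x) / μ
  have hSpos : 0 < S := div_pos (sub_pos.2 hxL) hμ
  have hμS : μ * S = L - x := mul_div_cancel₀ _ hμ.ne'
  have hcont : ContinuousOn (fun σ => β (x + μ * σ) (t - σ)) (Icc 0 S) := by
    refine hβ.continuousOn.comp (f := fun σ : ℝ => (x + μ * σ, t - σ)) (by fun_prop) ?_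
    intro σ hσ
    have h₀ := mul_nonneg hμ.le hσ.1
    have h₁ := mul_le_mul_of_nonneg_left hσ.2 hμ.le
    refine ⟨⟨?_, ?_⟩, ?_⟩ <;> simp only [mem_Ici] <;> linarith [hx.1, hσ.2]
  have hderiv : ∀ σ ∈ Ioo 0 S, HasDerivAt (fun σ => β (x + μ * σ) (t - σ)) 0 σ := by
    intro σ hσ
    have h₀ := mul_pos hμ hσ.1
    have h₁ := mul_lt_mul_of_pos_left hσ.2 hμ
    have hy : x + μ * σ ∈ Ioo 0 L := ⟨by linarith [hx.1], by linarith⟩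
    have hs : t - σ ∈ Ioi T := by simp only [mem_Ioi]; linarith [hσ.2]
    have hF := (hβ.differentiableAt (x := (x + μ * σ, t - σ)) (prod_mem_nhds
      (Icc_mem_nhds hy.1 hy.2) (Ici_mem_nhds (hT.trans_lt hs)))).hasFDerivAt
    set F := fderiv ℝ (uncurry β) (x + μ * σ, t - σ)
    have hdx : HasDerivAt (fun y => β y (t - σ)) (F (1, 0)) (x + μ * σ) :=
      hF.comp_hasDerivAt (f := fun y => (y, t - σ)) (x + μ * σ)
        ((hasDerivAt_id _).prodMk (hasDerivAt_const _ (t - σ)))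
    have hdt : HasDerivAt (fun s => β (x + μ * σ) s) (F (0, 1)) (t - σ) :=
      hF.comp_hasDerivAt (f := fun s => (x + μ * σ, s)) (t - σ)
        ((hasDerivAt_const _ (x + μ * σ)).prodMk (hasDerivAt_id _))
    have hpath : HasDerivAt (fun σ : ℝ => (x + μ * σ, t - σ)) (μ, -1) σ := by
      refine HasDerivAt.prodMk ?_ ?_
      · simpa using ((hasDerivAt_id σ).const_mul μ).const_add x
      · simpa using (hasDerivAt_id σ).const_sub t
    have hzero := hpde _ hy _ hs
    rw [hdx.deriv, hdt.deriv] at hzero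
    have hsplit : ((μ, -1) : ℝ × ℝ) = μ • (1, 0) - (0, 1) := by simp
    have hFzero : F (μ, -1) = 0 := by
      rw [hsplit, map_sub, map_smul, smul_eq_mul]
      linarith
    have h := hF.comp_hasDerivAt σ hpath
    rwa [hFzero] at h
  obtain ⟨c, -, hc⟩ := exists_hasDerivAt_eq_slope _ _ hSpos hcont hderiv
  have hend : β (x + μ * S) (t - S) = 0 := by
    rw [hμS, add_sub_cancel]
    exact hbc _ (by simp only [mem_Ici]; linarith)
  rw [eq_comm, div_eq_zero_iff, hend] at hc
  rcases hc with hc | hc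
  · simpa using hc
  · linarith


/-- Finite-time extinction of the cascaded β-subsystem of the control target
system: β_s vanishes for t ≥ (L−x)/μ₁ and β_f for t ≥ L/μ₁ + (L−x)/μ₂. -/
theorem stmt_11
    (L μ₁ μ₂ : ℝ) (hL : 0 < L) (hμ₁ : 0 < μ₁) (hμ₂ : 0 < μ₂)
    (θ : ℝ → ℝ) (hθ : ContinuousOn θ (Set.Icc 0 L))
    (βs βf : ℝ → ℝ → ℝ)
    (hβs : ContDiffOn ℝ 1 (Function.uncurry βs) (Set.Icc 0 L ×ˢ Set.Ici 0))
    (hβf : ContDiffOn ℝ 1 (Function.uncurry βf) (Set.Icc 0 L ×ˢ Set.Ici 0))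
    (hpde_s : ∀ x ∈ Set.Icc (0:ℝ) L, ∀ t ∈ Set.Ici (0:ℝ),
      deriv (fun s => βs x s) t - μ₁ * deriv (fun y => βs y t) x = 0)
    (hpde_f : ∀ x ∈ Set.Icc (0:ℝ) L, ∀ t ∈ Set.Ici (0:ℝ),
      deriv (fun s => βf x s) t - μ₂ * deriv (fun y => βf y t) x
        = θ x * βs 0 t)
    (hbc_s : ∀ t ∈ Set.Ici (0:ℝ), βs L t = 0)
    (hbc_f : ∀ t ∈ Set.Ici (0:ℝ), βf L t = 0) :
    (∀ x ∈ Set.Icc (0:ℝ) L, ∀ t : ℝ, (L - x) / μ₁ ≤ t → βs x t = 0) ∧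
    (∀ x ∈ Set.Icc (0:ℝ) L, ∀ t : ℝ, L / μ₁ + (L - x) / μ₂ ≤ t → βf x t = 0) := by
  have hs : ∀ x ∈ Set.Icc (0:ℝ) L, ∀ t : ℝ, (L - x) / μ₁ ≤ t → βs x t = 0 :=
    fun x hx t ht => transport_eq_zero_of_inflow_eq_zero hμ₁ le_rfl
      (hβs.differentiableOn one_ne_zero)
      (fun y hy s hs => hpde_s y (Set.Ioo_subset_Icc_self hy) s (Set.Ioi_subset_Ici_self hs))
      hbc_s hx (by rwa [zero_add])
  have hT : 0 ≤ L / μ₁ := (div_pos hL hμ₁).le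
  refine ⟨hs, fun x hx t ht => transport_eq_zero_of_inflow_eq_zero hμ₂ hT
    (hβf.differentiableOn one_ne_zero) (fun y hy s hsT => ?_)
    (fun s hsT => hbc_f s (hT.trans hsT)) hx ht⟩
  rw [hpde_f y (Set.Ioo_subset_Icc_self hy) s (hT.trans (le_of_lt hsT)),
    hs 0 ⟨le_rfl, hL.le⟩ s (by rw [sub_zero]; exact le_of_lt hsT), mul_zero]
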